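/- For n, m ∈ ℕ define φ_{n,m} : ℝ² → ℂ by φ_{n,m}(x,y) = (π n! m!)^{−1/2} · ((z̄ − ∂_z)^n (w ↦ w^m))(z) · e^{−(x²+y²)/2} with z = x + iy. Then φ_{n,m} is an eigenfunction of the magnetic (Landau) Hamiltonian in symmetric gauge with B = 2: ((−i∂_x + y)² + (−i∂_y − x)²) φ_{n,m} = (4n + 2) · φ_{n,m} pointwise on ℝ². In particular the eigenvalue 2B(n + ½) depends only on the Landau index n and not on m. -/

import Mathlib

noncomputable section

/-- Wirtinger derivative `∂_z F = ½(∂_x F − i ∂_y F)`. -/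
def dz (F : ℂ → ℂ) (z : ℂ) : ℂ :=
  (1 / 2 : ℂ) * (fderiv ℝ F z 1 - Complex.I * fderiv ℝ F z Complex.I)

/-- The operator `z̄ − ∂_z`. -/
def Tbar (F : ℂ → ℂ) : ℂ → ℂ := fun z => (starRingEnd ℂ) z * F z - dz F z

/-- The Landau-level basis function `φ_{n,m}` (units `B = 2`), as a function on
`ℝ² ≃ ℂ`, `z = x + iy`. -/
def phi (n m : ℕ) (z : ℂ) : ℂ :=
  (Real.sqrt (Real.pi * n.factorial * m.factorial) : ℂ)⁻¹
    * (Tbar^[n] (fun w => w ^ m)) z * Complex.exp (-(Complex.normSq z : ℂ) / 2)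

/-- The operator `−i∂_x + y` (with `x = Re z`, `y = Im z`, `∂_x F z = fderiv ℝ F z 1`). -/
def kinX (F : ℂ → ℂ) (z : ℂ) : ℂ := -Complex.I * fderiv ℝ F z 1 + (z.im : ℂ) * F z

/-- The operator `−i∂_y − x` (with `∂_y F z = fderiv ℝ F z I`). -/
def kinY (F : ℂ → ℂ) (z : ℂ) : ℂ := -Complex.I * fderiv ℝ F z Complex.I - (z.re : ℂ) * F z

open scoped ContDiff in
/-- A directional derivative of a smooth function is smooth. -/
theorem contDiff_fderiv_apply {F : ℂ → ℂ} (hF : ContDiff ℝ ∞ F) (v : ℂ) :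
    ContDiff ℝ ∞ (fun z => fderiv ℝ F z v) :=
  (hF.fderiv_right (m := ∞) le_rfl).clm_apply contDiff_const

open scoped ContDiff in
/-- Directional derivatives of a smooth function commute. -/
theorem fderiv_fderiv_comm {F : ℂ → ℂ} (hF : ContDiff ℝ ∞ F) (u v z : ℂ) :
    fderiv ℝ (fun w => fderiv ℝ F w u) z v = fderiv ℝ (fun w => fderiv ℝ F w v) z u := by
  have hd : DifferentiableAt ℝ (fderiv ℝ F) z :=
    (hF.fderiv_right (m := ∞) le_rfl).differentiable (by simp) z
  have hs : IsSymmSndFDerivAt ℝ F z :=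
    hF.contDiffAt.isSymmSndFDerivAt
      (by simpa using WithTop.coe_le_coe.2 (le_top (a := (2 : ℕ∞))))
  have key : ∀ a b : ℂ, fderiv ℝ (fun w => fderiv ℝ F w a) z b
      = fderiv ℝ (fderiv ℝ F) z b a := by
    intro a b
    rw [fderiv_clm_apply hd (differentiableAt_const a)]
    simp
  rw [key, key, hs.eq]

open scoped ContDiff in
theorem contDiff_conj : ContDiff ℝ ∞ (fun z : ℂ => (starRingEnd ℂ) z) :=
  Complex.conjCLE.contDiff

theorem fderiv_conj_apply (z v : ℂ) :
    fderiv ℝ (fun w : ℂ => (starRingEnd ℂ) w) z v = (starRingEnd ℂ) v := by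
  have h : HasFDerivAt (fun w : ℂ => (starRingEnd ℂ) w) (Complex.conjCLE : ℂ →L[ℝ] ℂ) z :=
    Complex.conjCLE.hasFDerivAt
  rw [h.fderiv]
  simp

theorem fderiv_mul_apply {F G : ℂ → ℂ} {z : ℂ} (hF : DifferentiableAt ℝ F z)
    (hG : DifferentiableAt ℝ G z) (v : ℂ) :
    fderiv ℝ (fun w => F w * G w) z v = F z * fderiv ℝ G z v + fderiv ℝ F z v * G z := by
  rw [fderiv_fun_mul hF hG]
  simp [mul_comm]

/-- Wirtinger derivative `∂_z̄ F = ½(∂_x F + i ∂_y F)`. -/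
def dzbar (F : ℂ → ℂ) (z : ℂ) : ℂ :=
  (1 / 2 : ℂ) * (fderiv ℝ F z 1 + Complex.I * fderiv ℝ F z Complex.I)

open scoped ContDiff in
theorem contDiff_dz {F : ℂ → ℂ} (hF : ContDiff ℝ ∞ F) : ContDiff ℝ ∞ (dz F) :=
  contDiff_const.mul ((contDiff_fderiv_apply hF 1).sub
    (contDiff_const.mul (contDiff_fderiv_apply hF Complex.I)))

open scoped ContDiff in
theorem contDiff_dzbar {F : ℂ → ℂ} (hF : ContDiff ℝ ∞ F) : ContDiff ℝ ∞ (dzbar F) :=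
  contDiff_const.mul ((contDiff_fderiv_apply hF 1).add
    (contDiff_const.mul (contDiff_fderiv_apply hF Complex.I)))

open scoped ContDiff in
theorem contDiff_Tbar {F : ℂ → ℂ} (hF : ContDiff ℝ ∞ F) : ContDiff ℝ ∞ (Tbar F) :=
  (contDiff_conj.mul hF).sub (contDiff_dz hF)

open scoped ContDiff in
theorem contDiff_Tbar_iterate {F : ℂ → ℂ} (hF : ContDiff ℝ ∞ F) (n : ℕ) :
    ContDiff ℝ ∞ (Tbar^[n] F) := by
  induction n with
  | zero => exact hF
  | succ n ih => rw [Function.iterate_succ_apply']; exact contDiff_Tbar ih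

theorem Tbar_const_mul {F : ℂ → ℂ} (hF : Differentiable ℝ F) (c : ℂ) :
    Tbar (fun z => c * F z) = fun z => c * Tbar F z := by
  funext z
  simp only [Tbar, dz, fderiv_mul_apply (differentiableAt_const c) (hF z), fderiv_fun_const]
  simp
  ring

open scoped ContDiff in
theorem fderiv_dz_apply {F : ℂ → ℂ} (hF : ContDiff ℝ ∞ F) (z v : ℂ) :
    fderiv ℝ (dz F) z v = (1 / 2 : ℂ) * (fderiv ℝ (fun w => fderiv ℝ F w 1) z v
      - Complex.I * fderiv ℝ (fun w => fderiv ℝ F w Complex.I) z v) := by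
  have h (u : ℂ) : DifferentiableAt ℝ (fun w => fderiv ℝ F w u) z :=
    (contDiff_fderiv_apply hF u).differentiable (by simp) z
  have e := (((h 1).hasFDerivAt.sub ((h Complex.I).hasFDerivAt.const_mul Complex.I)).const_mul
    (1 / 2 : ℂ)).fderiv
  exact congrArg (fun L : ℂ →L[ℝ] ℂ => L v) e

open scoped ContDiff in
theorem fderiv_dzbar_apply {F : ℂ → ℂ} (hF : ContDiff ℝ ∞ F) (z v : ℂ) :
    fderiv ℝ (dzbar F) z v = (1 / 2 : ℂ) * (fderiv ℝ (fun w => fderiv ℝ F w 1) z v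
      + Complex.I * fderiv ℝ (fun w => fderiv ℝ F w Complex.I) z v) := by
  have h (u : ℂ) : DifferentiableAt ℝ (fun w => fderiv ℝ F w u) z :=
    (contDiff_fderiv_apply hF u).differentiable (by simp) z
  have e := (((h 1).hasFDerivAt.add ((h Complex.I).hasFDerivAt.const_mul Complex.I)).const_mul
    (1 / 2 : ℂ)).fderiv
  exact congrArg (fun L : ℂ →L[ℝ] ℂ => L v) e

open scoped ContDiff in
theorem fderiv_Tbar_apply {F : ℂ → ℂ} (hF : ContDiff ℝ ∞ F) (z v : ℂ) :
    fderiv ℝ (Tbar F) z v = (starRingEnd ℂ) z * fderiv ℝ F z v + (starRingEnd ℂ) v * F z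
      - fderiv ℝ (dz F) z v := by
  have hc : DifferentiableAt ℝ (fun z : ℂ => (starRingEnd ℂ) z) z :=
    contDiff_conj.differentiable (by simp) z
  have hd : DifferentiableAt ℝ F z := hF.differentiable (by simp) z
  have hz : DifferentiableAt ℝ (dz F) z := (contDiff_dz hF).differentiable (by simp) z
  unfold Tbar
  rw [fderiv_fun_sub (hc.fun_mul hd) hz, sub_apply, fderiv_mul_apply hc hd, fderiv_conj_apply]

open scoped ContDiff in
/-- The commutation relation `[∂_z̄, z̄ − ∂_z] = 1`. -/
theorem dzbar_Tbar {F : ℂ → ℂ} (hF : ContDiff ℝ ∞ F) (z : ℂ) :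
    dzbar (Tbar F) z = Tbar (dzbar F) z + F z := by
  rw [dzbar, fderiv_Tbar_apply hF, fderiv_Tbar_apply hF, fderiv_dz_apply hF, fderiv_dz_apply hF,
    Tbar, dz, fderiv_dzbar_apply hF, fderiv_dzbar_apply hF, dzbar,
    fderiv_fderiv_comm hF Complex.I 1]
  simp only [map_one, Complex.conj_I]
  linear_combination (-(1 / 2 : ℂ) * F z) * Complex.I_sq

theorem dzbar_pow (m : ℕ) (z : ℂ) : dzbar (fun w => w ^ m) z = 0 := by
  have h : HasFDerivAt (fun w : ℂ => w ^ m)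
      ((ContinuousLinearMap.toSpanSingleton ℂ (m * z ^ (m - 1) : ℂ)).restrictScalars ℝ) z :=
    (hasDerivAt_pow m z).hasFDerivAt.restrictScalars ℝ
  rw [dzbar, h.fderiv]
  simp
  linear_combination ((m : ℂ) * z ^ (m - 1)) * Complex.I_sq

theorem contDiff_pow_complex (m : ℕ) : ContDiff ℝ (⊤ : ℕ∞) (fun w : ℂ => w ^ m) :=
  contDiff_id.pow m

/-- `(z̄ − ∂_z) ∂_z̄` acts as the number operator on `(z̄ − ∂_z)^n z^m`. -/
theorem Tbar_dzbar_iterate (n m : ℕ) (z : ℂ) :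
    Tbar (dzbar (Tbar^[n] (fun w => w ^ m))) z = n * (Tbar^[n] (fun w => w ^ m)) z := by
  induction n generalizing z with
  | zero =>
    have h : dzbar (fun w : ℂ => w ^ m) = fun _ => 0 := funext (dzbar_pow m)
    simp [h, Tbar, dz]
  | succ n ih =>
    have hs := contDiff_Tbar_iterate (contDiff_pow_complex m) n
    have h : dzbar (Tbar (Tbar^[n] (fun w => w ^ m)))
        = fun w => ((n : ℂ) + 1) * (Tbar^[n] (fun w => w ^ m)) w := by
      funext w
      rw [dzbar_Tbar hs, ih]
      ring
    rw [Function.iterate_succ_apply', h, Tbar_const_mul (hs.differentiable (by simp))]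
    push_cast
    rfl

theorem fderiv_gaussian_apply (z v : ℂ) :
    DifferentiableAt ℝ (fun w : ℂ => Complex.exp (-(Complex.normSq w : ℂ) / 2)) z ∧
    fderiv ℝ (fun w : ℂ => Complex.exp (-(Complex.normSq w : ℂ) / 2)) z v
      = -(v * (starRingEnd ℂ) z + z * (starRingEnd ℂ) v) / 2
        * Complex.exp (-(Complex.normSq z : ℂ) / 2) := by
  simp only [← Complex.mul_conj]
  have hc : HasFDerivAt (fun w : ℂ => (starRingEnd ℂ) w) (Complex.conjCLE : ℂ →L[ℝ] ℂ) z :=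
    Complex.conjCLE.hasFDerivAt
  have h := ((((hasFDerivAt_id (𝕜 := ℝ) z).mul hc).neg).mul_const (2⁻¹ : ℂ)).cexp
  simp only [div_eq_mul_inv]
  refine ⟨h.differentiableAt, ?_⟩
  have e := congrArg (fun L : ℂ →L[ℝ] ℂ => L v) h.fderiv
  refine e.trans ?_
  simp
  ring

theorem kinX_mul_gaussian {G : ℂ → ℂ} (hG : Differentiable ℝ G) :
    kinX (fun w => G w * Complex.exp (-(Complex.normSq w : ℂ) / 2))
      = fun w => (-Complex.I * fderiv ℝ G w 1 + Complex.I * (starRingEnd ℂ) w * G w)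
        * Complex.exp (-(Complex.normSq w : ℂ) / 2) := by
  funext z
  rw [kinX, fderiv_mul_apply (hG z) (fderiv_gaussian_apply z 1).1, (fderiv_gaussian_apply z 1).2]
  have h1 : z = z.re + z.im * Complex.I := (Complex.re_add_im z).symm
  have h2 : (starRingEnd ℂ) z = z.re - z.im * Complex.I := by
    apply Complex.ext <;> simp
  generalize Complex.exp (-(Complex.normSq z : ℂ) / 2) = E
  rw [h2, map_one]
  linear_combination (Complex.I * G z * E / 2) * h1 + (z.im * G z * E) * Complex.I_sq

theorem kinY_mul_gaussian {G : ℂ → ℂ} (hG : Differentiable ℝ G) :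
    kinY (fun w => G w * Complex.exp (-(Complex.normSq w : ℂ) / 2))
      = fun w => (-Complex.I * fderiv ℝ G w Complex.I - (starRingEnd ℂ) w * G w)
        * Complex.exp (-(Complex.normSq w : ℂ) / 2) := by
  funext z
  rw [kinY, fderiv_mul_apply (hG z) (fderiv_gaussian_apply z 1).1,
    (fderiv_gaussian_apply z Complex.I).2]
  have h1 : z = z.re + z.im * Complex.I := (Complex.re_add_im z).symm
  have h2 : (starRingEnd ℂ) z = z.re - z.im * Complex.I := by
    apply Complex.ext <;> simp
  generalize Complex.exp (-(Complex.normSq z : ℂ) / 2) = E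
  rw [h2, Complex.conj_I]
  linear_combination (-Complex.I ^ 2 * G z * E / 2) * h1 -
    (z.im * Complex.I * G z * E) * Complex.I_sq

open scoped ContDiff in
/-- After factoring out the Gaussian, the Landau Hamiltonian becomes `4 (z̄ − ∂_z) ∂_z̄ + 2`. -/
theorem landau_mul_gaussian {G : ℂ → ℂ} (hG : ContDiff ℝ ∞ G) (z : ℂ) :
    kinX (kinX (fun w => G w * Complex.exp (-(Complex.normSq w : ℂ) / 2))) z
      + kinY (kinY (fun w => G w * Complex.exp (-(Complex.normSq w : ℂ) / 2))) z
      = (4 * Tbar (dzbar G) z + 2 * G z) * Complex.exp (-(Complex.normSq z : ℂ) / 2) := by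
  have hd : Differentiable ℝ G := hG.differentiable (by simp)
  have hu (u : ℂ) : Differentiable ℝ (fun w => fderiv ℝ G w u) :=
    (contDiff_fderiv_apply hG u).differentiable (by simp)
  have hc : Differentiable ℝ (fun z : ℂ => (starRingEnd ℂ) z) :=
    contDiff_conj.differentiable (by simp)
  have hlin (a b u v : ℂ) : fderiv ℝ (fun w => a * fderiv ℝ G w u
      + b * ((starRingEnd ℂ) w * G w)) z v = a * fderiv ℝ (fun w => fderiv ℝ G w u) z v
      + b * ((starRingEnd ℂ) z * fderiv ℝ G z v + (starRingEnd ℂ) v * G z) := by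
    have e := (((hu u z).hasFDerivAt.const_mul a).add
      (((hc.mul hd) z).hasFDerivAt.const_mul b)).fderiv
    have e' := congrArg (fun L : ℂ →L[ℝ] ℂ => L v) e
    refine e'.trans ?_
    have := fderiv_mul_apply (hc z) (hd z) v
    rw [fderiv_conj_apply] at this
    rw [← this]
    rfl
  have hX : (fun w => -Complex.I * fderiv ℝ G w 1 + Complex.I * (starRingEnd ℂ) w * G w)
      = fun w => -Complex.I * fderiv ℝ G w 1 + Complex.I * ((starRingEnd ℂ) w * G w) := by
    funext w; ring
  have hY : (fun w => -Complex.I * fderiv ℝ G w Complex.I - (starRingEnd ℂ) w * G w)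
      = fun w => -Complex.I * fderiv ℝ G w Complex.I + (-1) * ((starRingEnd ℂ) w * G w) := by
    funext w; ring
  have dX : Differentiable ℝ
      (fun w => -Complex.I * fderiv ℝ G w 1 + Complex.I * (starRingEnd ℂ) w * G w) :=
    ((hu 1).const_mul _).add ((hc.const_mul _).mul hd)
  have dY : Differentiable ℝ
      (fun w => -Complex.I * fderiv ℝ G w Complex.I - (starRingEnd ℂ) w * G w) :=
    ((hu Complex.I).const_mul _).sub (hc.mul hd)
  rw [kinX_mul_gaussian hd, kinX_mul_gaussian dX, kinY_mul_gaussian hd, kinY_mul_gaussian dY,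
    hX, hY]
  simp only [hlin]
  rw [Tbar, dz, fderiv_dzbar_apply hG, fderiv_dzbar_apply hG, dzbar,
    fderiv_fderiv_comm hG Complex.I 1]
  simp only [map_one, Complex.conj_I]
  generalize Complex.exp (-(Complex.normSq z : ℂ) / 2) = E
  ring_nf
  simp only [Complex.I_sq]
  ring

/-- `φ_{n,m}` is an eigenfunction of the Landau Hamiltonian in symmetric
gauge with `B = 2`: `((−i∂_x + y)² + (−i∂_y − x)²) φ_{n,m} = (4n + 2) φ_{n,m}` pointwise;
the eigenvalue `2B(n + ½)` depends only on `n`, not on `m`. -/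
theorem stmt6 (n m : ℕ) :
    ∀ z : ℂ, kinX (fun w => kinX (phi n m) w) z + kinY (fun w => kinY (phi n m) w) z
      = (4 * (n : ℂ) + 2) * phi n m z := by
  intro z
  set c : ℂ := (Real.sqrt (Real.pi * n.factorial * m.factorial) : ℂ)⁻¹
  have hs := contDiff_Tbar_iterate (contDiff_pow_complex m) n
  have hd := hs.differentiable (by simp)
  have hphi : phi n m = fun w => (c * (Tbar^[n] (fun w => w ^ m)) w)
      * Complex.exp (-(Complex.normSq w : ℂ) / 2) := rfl
  have hbar : dzbar (fun w => c * (Tbar^[n] (fun w => w ^ m)) w)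
      = fun w => c * dzbar (Tbar^[n] (fun w => w ^ m)) w := by
    funext w
    simp only [dzbar, fderiv_mul_apply (differentiableAt_const c) (hd w), fderiv_fun_const]
    simp
    ring
  have h := landau_mul_gaussian (contDiff_const.mul hs : ContDiff ℝ _
    (fun w => c * (Tbar^[n] (fun w => w ^ m)) w)) z
  rw [hbar, Tbar_const_mul ((contDiff_dzbar hs).differentiable (by simp))] at h
  simp only [Tbar_dzbar_iterate] at h
  rw [hphi]
  refine h.trans ?_
  ring
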